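/- arXiv:2308.05488 — 2 statements merged into one kernel-verified Lean document; each statement's English description precedes it below -/
import Mathlib

section
/- Let A_w be an n_w×n_w and B_w an n_w×m complex matrix with A_w A_wᴴ + B_w B_wᴴ = I, let A_v be an n_v×n_v and B_v an n_v×m complex matrix, let X be an n_v×n_w matrix satisfying the Stein equation X = A_v X A_wᴴ + B_v B_wᴴ, and set Q = I − Xᴴ X. Then for every integer k ≥ 1, a vector x ∈ ℂ^{n_w} satisfies (I − A_w^k Q (A_wᴴ)^k) x = 0 if and only if B_wᴴ (A_wᴴ)^j x = 0 and X (A_wᴴ)^{j+1} x = 0 for every j with 0 ≤ j ≤ k−1; that is, ker(I − A_w^k Q (A_wᴴ)^k) = ⋂_{j=0}^{k−1} ( ker(B_wᴴ (A_wᴴ)^j) ∩ ker(X (A_wᴴ)^{j+1}) ). -/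
open Matrix

/-- The kernel of a sum of Gram matrices is the intersection of the kernels of the factors. -/
theorem gram_sum_add_mulVec_eq_zero_iff {ι p q n : Type*} [Fintype p] [Fintype q] [Fintype n]
    (s : Finset ι) (C : ι → Matrix p n ℂ) (D : Matrix q n ℂ) (x : n → ℂ) :
    (∑ j ∈ s, (C j)ᴴ * C j + Dᴴ * D) *ᵥ x = 0 ↔ (∀ j ∈ s, C j *ᵥ x = 0) ∧ D *ᵥ x = 0 := by
  open scoped ComplexOrder in
  constructor
  · intro h
    have key : ∑ j ∈ s, star (C j *ᵥ x) ⬝ᵥ (C j *ᵥ x) + star (D *ᵥ x) ⬝ᵥ (D *ᵥ x) = 0 := by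
      have h' := congrArg (star x ⬝ᵥ ·) h
      simpa [add_mulVec, sum_mulVec, dotProduct_add, dotProduct_sum, star_mulVec,
        ← mulVec_mulVec, dotProduct_mulVec] using h'
    rw [add_eq_zero_iff_of_nonneg (Finset.sum_nonneg fun _ _ => dotProduct_star_self_nonneg _)
      (dotProduct_star_self_nonneg _),
      Finset.sum_eq_zero_iff_of_nonneg fun _ _ => dotProduct_star_self_nonneg _] at key
    simpa only [dotProduct_star_self_eq_zero] using key
  · rintro ⟨hC, hD⟩
    rw [add_mulVec, sum_mulVec, ← mulVec_mulVec, hD, mulVec_zero, add_zero]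
    exact Finset.sum_eq_zero fun j hj => by rw [← mulVec_mulVec, hC j hj, mulVec_zero]

/-- Iterating `A Aᴴ + B Bᴴ = 1` gives `∑_{j<k} Aʲ B Bᴴ (Aᴴ)ʲ + Aᵏ (Aᴴ)ᵏ = 1`. -/
theorem sum_gram_add_pow_mul_conjTranspose_pow {n p : Type*} [Fintype n] [DecidableEq n]
    [Fintype p] {A : Matrix n n ℂ} {B : Matrix n p ℂ} (h : A * Aᴴ + B * Bᴴ = 1) (k : ℕ) :
    ∑ j ∈ Finset.range k, (Bᴴ * Aᴴ ^ j)ᴴ * (Bᴴ * Aᴴ ^ j) + A ^ k * Aᴴ ^ k = 1 := by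
  induction k with
  | zero => simp
  | succ k ih =>
    have hstep : (Bᴴ * Aᴴ ^ k)ᴴ * (Bᴴ * Aᴴ ^ k) + A ^ (k + 1) * Aᴴ ^ (k + 1) =
        A ^ k * (A * Aᴴ + B * Bᴴ) * Aᴴ ^ k := by
      rw [conjTranspose_mul, conjTranspose_pow, conjTranspose_conjTranspose,
        conjTranspose_conjTranspose, pow_succ, pow_succ']
      simp only [Matrix.mul_add, Matrix.add_mul, Matrix.mul_assoc]
      exact add_comm _ _
    rw [Finset.sum_range_succ, add_assoc, hstep, h, Matrix.mul_one, ih]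

/-- With `A_w A_wᴴ + B_w B_wᴴ = I`, `X` the solution of the Stein equation
`X = A_v X A_wᴴ + B_v B_wᴴ` and `Q = I - Xᴴ X`, for every `k ≥ 1` the kernel of
`I - A_wᵏ Q (A_wᴴ)ᵏ` consists precisely of the vectors `x` with
`B_wᴴ (A_wᴴ)ʲ x = 0` and `X (A_wᴴ)^{j+1} x = 0` for all `0 ≤ j ≤ k-1`. -/
theorem stmt_7 {nv nw m : ℕ}
    (Aw : Matrix (Fin nw) (Fin nw) ℂ) (Bw : Matrix (Fin nw) (Fin m) ℂ)
    (Av : Matrix (Fin nv) (Fin nv) ℂ) (Bv : Matrix (Fin nv) (Fin m) ℂ)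
    (hw : Aw * Awᴴ + Bw * Bwᴴ = 1)
    (X : Matrix (Fin nv) (Fin nw) ℂ)
    (hX : X = Av * X * Awᴴ + Bv * Bwᴴ)
    (Q : Matrix (Fin nw) (Fin nw) ℂ)
    (hQ : Q = 1 - Xᴴ * X)
    (k : ℕ) (hk : 1 ≤ k) (x : Fin nw → ℂ) :
    (1 - Aw ^ k * Q * Awᴴ ^ k) *ᵥ x = 0 ↔
      ∀ j < k, Bwᴴ *ᵥ (Awᴴ ^ j *ᵥ x) = 0 ∧ X *ᵥ (Awᴴ ^ (j + 1) *ᵥ x) = 0 := by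
  have hM : 1 - Aw ^ k * Q * Awᴴ ^ k =
      ∑ j ∈ Finset.range k, (Bwᴴ * Awᴴ ^ j)ᴴ * (Bwᴴ * Awᴴ ^ j) +
        (X * Awᴴ ^ k)ᴴ * (X * Awᴴ ^ k) := by
    nth_rw 1 [← sum_gram_add_pow_mul_conjTranspose_pow hw k]
    rw [hQ, conjTranspose_mul X, conjTranspose_pow Awᴴ, conjTranspose_conjTranspose Aw]
    simp only [Matrix.mul_sub, Matrix.sub_mul, Matrix.mul_one, Matrix.mul_assoc]
    abel
  rw [hM, gram_sum_add_mulVec_eq_zero_iff]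
  simp only [Finset.mem_range, ← mulVec_mulVec]
  constructor
  · rintro ⟨hB, hXk⟩
    have hXj : ∀ j ≤ k, X *ᵥ (Awᴴ ^ j *ᵥ x) = 0 := by
      intro j hj
      induction hj using Nat.decreasingInduction with
      | self => exact hXk
      | of_succ j hj ih =>
        rw [pow_succ', ← mulVec_mulVec] at ih
        rw [hX, add_mulVec, ← mulVec_mulVec, ← mulVec_mulVec, ← mulVec_mulVec, ih, hB j hj,
          mulVec_zero, mulVec_zero, add_zero]
    exact fun j hj => ⟨hB j hj, hXj (j + 1) hj⟩
  · intro h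
    refine ⟨fun j hj => (h j hj).1, ?_⟩
    simpa [Nat.sub_add_cancel hk] using (h (k - 1) (by omega)).2
end

section
/- Let A be an n×n complex matrix such that I − Aᴴ A is positive semidefinite of rank 1 and every eigenvalue of A lies in the open unit disc, and let φ be a finite Blaschke product of degree d. Then the rank of I − A Aᴴ also equals 1, and rank(I − φ(A)ᴴ φ(A)) = rank(I − φ(Aᴴ)ᴴ φ(Aᴴ)) = min(d, n); that is, the defect indices of φ(A) and of φ(Aᴴ) both equal min(d, n). -/
open Matrix ComplexOrder

/-- `φ(A)` for the finite Blaschke product `φ` determined by the unimodular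
constant `ζ` and the zeros `α 0, …, α (d-1)` in the open unit disc:
`φ(A) = ζ • ∏ₖ (A - αₖ I)(I - conj(αₖ) A)⁻¹`.  The factors commute, so the
order of the product is immaterial. -/
noncomputable def blaschkeMatrix {n d : ℕ} (ζ : ℂ) (α : Fin d → ℂ)
    (A : Matrix (Fin n) (Fin n) ℂ) : Matrix (Fin n) (Fin n) ℂ :=
  ζ • (List.ofFn fun k : Fin d =>
    (A - α k • 1) * (1 - (starRingEnd ℂ) (α k) • A)⁻¹).prod

open Module

section Contraction

variable {ι : Type*} [Fintype ι]

lemma Matrix.PosSemidef.mulVec_eq_zero_of_add {M N : Matrix ι ι ℂ} (hM : M.PosSemidef)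
    (hN : N.PosSemidef) {x : ι → ℂ} (h : (M + N) *ᵥ x = 0) : M *ᵥ x = 0 ∧ N *ᵥ x = 0 := by
  have hsum : star x ⬝ᵥ (M *ᵥ x) + star x ⬝ᵥ (N *ᵥ x) = 0 := by
    rw [← dotProduct_add, ← add_mulVec, h, dotProduct_zero]
  rw [add_eq_zero_iff_of_nonneg (hM.dotProduct_mulVec_nonneg x)
    (hN.dotProduct_mulVec_nonneg x)] at hsum
  exact ⟨(hM.dotProduct_mulVec_zero_iff x).1 hsum.1, (hN.dotProduct_mulVec_zero_iff x).1 hsum.2⟩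

lemma finrank_ker_add_rank (M : Matrix ι ι ℂ) :
    finrank ℂ (LinearMap.ker M.mulVecLin) + M.rank = Fintype.card ι := by
  have := M.mulVecLin.finrank_range_add_finrank_ker
  rw [finrank_fintype_fun_eq_card] at this
  rw [Matrix.rank]
  lia

lemma rank_add_le_rank_add_rank (M N : Matrix ι ι ℂ) : (M + N).rank ≤ M.rank + N.rank := by
  have hle : LinearMap.range (M + N).mulVecLin ≤
      LinearMap.range M.mulVecLin ⊔ LinearMap.range N.mulVecLin := by
    rintro _ ⟨x, rfl⟩
    rw [mulVecLin_add]
    exact Submodule.add_mem_sup ⟨x, rfl⟩ ⟨x, rfl⟩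
  exact (Submodule.finrank_mono hle).trans (Submodule.finrank_add_le_finrank_add_finrank _ _)

variable [DecidableEq ι]

lemma one_sub_conjTranspose_mul_self_mul (C D : Matrix ι ι ℂ) :
    1 - (C * D)ᴴ * (C * D) = (1 - Dᴴ * D) + Dᴴ * (1 - Cᴴ * C) * D := by
  rw [conjTranspose_mul]
  noncomm_ring

lemma posSemidef_one_sub_mul {C D : Matrix ι ι ℂ} (hC : (1 - Cᴴ * C).PosSemidef)
    (hD : (1 - Dᴴ * D).PosSemidef) : (1 - (C * D)ᴴ * (C * D)).PosSemidef := by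
  rw [one_sub_conjTranspose_mul_self_mul]
  exact hD.add (hC.conjTranspose_mul_mul_same D)

lemma mulVec_eq_zero_of_one_sub_mul {C D : Matrix ι ι ℂ} (hC : (1 - Cᴴ * C).PosSemidef)
    (hD : (1 - Dᴴ * D).PosSemidef) {x : ι → ℂ} (h : (1 - (C * D)ᴴ * (C * D)) *ᵥ x = 0) :
    (1 - Dᴴ * D) *ᵥ x = 0 ∧ (1 - Cᴴ * C) *ᵥ (D *ᵥ x) = 0 := by
  rw [one_sub_conjTranspose_mul_self_mul] at h
  obtain ⟨h₁, h₂⟩ := hD.mulVec_eq_zero_of_add (hC.conjTranspose_mul_mul_same D) h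
  refine ⟨h₁, (hC.dotProduct_mulVec_zero_iff _).1 ?_⟩
  rw [star_mulVec, ← dotProduct_mulVec, mulVec_mulVec, mulVec_mulVec, h₂, dotProduct_zero]

lemma norm_eq_one_of_isometric_eigenvector {B : Matrix ι ι ℂ} {x : ι → ℂ} (hx : x ≠ 0)
    {μ : ℂ} (hμ : B *ᵥ x = μ • x) (h : (1 - Bᴴ * B) *ᵥ x = 0) : ‖μ‖ = 1 := by
  have h' : star x ⬝ᵥ ((1 - Bᴴ * B) *ᵥ x) = 0 := by rw [h, dotProduct_zero]
  rw [sub_mulVec, one_mulVec, dotProduct_sub, ← mulVec_mulVec, dotProduct_mulVec, ← star_mulVec,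
    hμ, star_smul, smul_dotProduct, dotProduct_smul, smul_smul, smul_eq_mul, ← one_sub_mul] at h'
  have hne : star x ⬝ᵥ x ≠ 0 := by simpa using hx
  have h1 : star μ * μ = 1 := by
    have := (mul_eq_zero.1 h').resolve_right hne
    linear_combination -this
  have h2 : ‖μ‖ * ‖μ‖ = 1 := by simpa using congrArg norm h1
  nlinarith [norm_nonneg μ]

/-- Removing a factor without unimodular eigenvalues strictly enlarges the isometric subspace of
a product of commuting contractions, unless that of the product is trivial. -/
lemma rank_one_sub_lt_rank_one_sub_mul {B Q : Matrix ι ι ℂ} (hB : (1 - Bᴴ * B).PosSemidef)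
    (hQ : (1 - Qᴴ * Q).PosSemidef) (hBQ : Commute B Q)
    (hev : ∀ (μ : ℂ) (x : ι → ℂ), x ≠ 0 → B *ᵥ x = μ • x → ‖μ‖ ≠ 1)
    (hr : (1 - (B * Q)ᴴ * (B * Q)).rank < Fintype.card ι) :
    (1 - Qᴴ * Q).rank < (1 - (B * Q)ᴴ * (B * Q)).rank := by
  set K := LinearMap.ker (1 - (B * Q)ᴴ * (B * Q)).mulVecLin with hK
  have hle : K ≤ LinearMap.ker (1 - Qᴴ * Q).mulVecLin := fun x hx ↦
    (mulVec_eq_zero_of_one_sub_mul hB hQ hx).1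
  have key : ∀ x ∈ K, (1 - Bᴴ * B) *ᵥ x = 0 ∧ (1 - Qᴴ * Q) *ᵥ (B *ᵥ x) = 0 := fun x hx ↦ by
    rw [hK, hBQ.eq] at hx
    exact mulVec_eq_zero_of_one_sub_mul hQ hB hx
  have e₁ := finrank_ker_add_rank (1 - Qᴴ * Q)
  have e₂ := finrank_ker_add_rank (1 - (B * Q)ᴴ * (B * Q))
  rw [← hK] at e₂
  suffices K < LinearMap.ker (1 - Qᴴ * Q).mulVecLin by
    have := Submodule.finrank_lt_finrank_of_lt this
    lia
  refine lt_of_le_of_ne hle fun heq ↦ ?_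
  have hinv : ∀ x ∈ K, B.mulVecLin x ∈ K := fun x hx ↦ by
    rw [heq]
    exact (key x hx).2
  have : Nontrivial K := Module.nontrivial_of_finrank_pos (R := ℂ) (by lia)
  obtain ⟨μ, hμ⟩ := Module.End.exists_eigenvalue (B.mulVecLin.restrict hinv)
  obtain ⟨x, hx⟩ := hμ.exists_hasEigenvector
  have hx0 : (x : ι → ℂ) ≠ 0 := by simpa using hx.2
  have hBx : B *ᵥ (x : ι → ℂ) = μ • (x : ι → ℂ) := congrArg Subtype.val hx.apply_eq_smul
  exact hev μ x hx0 hBx (norm_eq_one_of_isometric_eigenvector hx0 hBx (key x x.2).1)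

/-- The defect index of a product of commuting contractions of defect index at most one, none of
which has a unimodular eigenvalue. -/
lemma rank_one_sub_list_prod (L : List (Matrix ι ι ℂ))
    (hL : ∀ B ∈ L, (1 - Bᴴ * B).PosSemidef) (hrank : ∀ B ∈ L, (1 - Bᴴ * B).rank ≤ 1)
    (hev : ∀ B ∈ L, ∀ (μ : ℂ) (x : ι → ℂ), x ≠ 0 → B *ᵥ x = μ • x → ‖μ‖ ≠ 1)
    (hcomm : ∀ B ∈ L, ∀ C ∈ L, Commute B C) :
    (1 - L.prodᴴ * L.prod).PosSemidef ∧
      (1 - L.prodᴴ * L.prod).rank = min L.length (Fintype.card ι) := by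
  induction L with
  | nil => simp [PosSemidef.zero]
  | cons B L ih =>
    obtain ⟨hQ, hQrank⟩ := ih (fun C hC ↦ hL C (by simp [hC])) (fun C hC ↦ hrank C (by simp [hC]))
      (fun C hC ↦ hev C (by simp [hC])) (fun C hC D hD ↦ hcomm C (by simp [hC]) D (by simp [hD]))
    have hB := hL B (by simp)
    have hBQ : Commute B L.prod :=
      Commute.list_prod_right L B fun C hC ↦ hcomm B (by simp) C (by simp [hC])
    rw [List.prod_cons, List.length_cons]
    refine ⟨posSemidef_one_sub_mul hB hQ, ?_⟩
    have hlt := rank_one_sub_lt_rank_one_sub_mul hB hQ hBQ (hev B (by simp))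
    have hcard := rank_le_card_width (1 - (B * L.prod)ᴴ * (B * L.prod))
    have hle : (1 - (B * L.prod)ᴴ * (B * L.prod)).rank ≤ (1 - L.prodᴴ * L.prod).rank + 1 := by
      rw [one_sub_conjTranspose_mul_self_mul]
      exact (rank_add_le_rank_add_rank _ _).trans (Nat.add_le_add_left
        ((rank_mul_le_left _ _).trans ((rank_mul_le_right _ _).trans (hrank B (by simp)))) _)
    lia

lemma posSemidef_one_sub_mul_conjTranspose {A : Matrix ι ι ℂ} (hA : (1 - Aᴴ * A).PosSemidef) :
    (1 - A * Aᴴ).PosSemidef := by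
  have h : 1 - A * Aᴴ = (1 - A * Aᴴ)ᴴ * (1 - A * Aᴴ) + A * (1 - Aᴴ * A) * Aᴴ := by
    rw [conjTranspose_sub, conjTranspose_one, conjTranspose_mul, conjTranspose_conjTranspose]
    noncomm_ring
  rw [h]
  exact (posSemidef_conjTranspose_mul_self _).add (hA.mul_mul_conjTranspose_same A)

lemma rank_one_sub_mul_le_comm (A B : Matrix ι ι ℂ) : (1 - A * B).rank ≤ (1 - B * A).rank := by
  have hmem : ∀ x ∈ LinearMap.ker (1 - B * A).mulVecLin, A.mulVecLin x ∈
      LinearMap.ker (1 - A * B).mulVecLin := fun x hx ↦ by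
    have hx' : (1 - B * A) *ᵥ x = 0 := hx
    have : (1 - A * B) * A = A * (1 - B * A) := by noncomm_ring
    change (1 - A * B) *ᵥ (A *ᵥ x) = 0
    rw [mulVec_mulVec, this, ← mulVec_mulVec, hx', mulVec_zero]
  have hinj : Function.Injective (A.mulVecLin.restrict hmem) := by
    rw [← LinearMap.ker_eq_bot, LinearMap.ker_eq_bot']
    rintro ⟨x, hx⟩ h
    have hAx : A *ᵥ x = 0 := congrArg Subtype.val h
    have hx' : (1 - B * A) *ᵥ x = 0 := hx
    rw [sub_mulVec, one_mulVec, ← mulVec_mulVec, hAx, mulVec_zero, sub_zero] at hx'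
    exact Subtype.ext hx'
  have := LinearMap.finrank_le_finrank_of_injective hinj
  have e₁ := finrank_ker_add_rank (1 - A * B)
  have e₂ := finrank_ker_add_rank (1 - B * A)
  lia

end Contraction

section Moebius

variable {ι : Type*} [Fintype ι] [DecidableEq ι] {A : Matrix ι ι ℂ} {a : ℂ}

lemma mem_spectrum_of_mulVec_eq_smul {μ : ℂ} {x : ι → ℂ} (hx : x ≠ 0) (h : A *ᵥ x = μ • x) :
    μ ∈ spectrum ℂ A := by
  rw [← Matrix.spectrum_toLin', ← Module.End.hasEigenvalue_iff_mem_spectrum]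
  exact Module.End.hasEigenvalue_of_hasEigenvector
    ⟨Module.End.mem_eigenspace_iff.2 (by simpa using h), hx⟩

lemma isUnit_det_one_sub_conj_smul (hA : ∀ μ ∈ spectrum ℂ A, ‖μ‖ < 1) (ha : ‖a‖ < 1) :
    IsUnit (1 - (starRingEnd ℂ) a • A).det := by
  rw [isUnit_iff_ne_zero]
  intro h
  obtain ⟨x, hx, hAx⟩ := exists_mulVec_eq_zero_iff.2 h
  rw [sub_mulVec, one_mulVec, smul_mulVec, sub_eq_zero] at hAx
  have ha0 : (starRingEnd ℂ) a ≠ 0 := fun h0 ↦ hx (by rw [hAx, h0, zero_smul])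
  have hmem := hA _ (mem_spectrum_of_mulVec_eq_smul (A := A) (μ := ((starRingEnd ℂ) a)⁻¹) hx
    (by rw [eq_inv_smul_iff₀ ha0, ← hAx]))
  rw [norm_inv, RCLike.norm_conj] at hmem
  have hpos : 0 < ‖a‖ := by simpa using ha0
  exact absurd (one_lt_inv₀ hpos |>.2 ha) (not_lt.2 hmem.le)

lemma one_sub_conjTranspose_mul_moebius (h : IsUnit (1 - (starRingEnd ℂ) a • A).det) :
    1 - ((A - a • 1) * (1 - (starRingEnd ℂ) a • A)⁻¹)ᴴ *
        ((A - a • 1) * (1 - (starRingEnd ℂ) a • A)⁻¹) =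
      ((1 - ‖a‖ ^ 2 : ℝ) : ℂ) • (((1 - (starRingEnd ℂ) a • A)⁻¹)ᴴ * (1 - Aᴴ * A) *
        (1 - (starRingEnd ℂ) a • A)⁻¹) := by
  set V := 1 - (starRingEnd ℂ) a • A with hV
  have hVU : V * V⁻¹ = 1 := mul_nonsing_inv V h
  have hUV : V⁻¹ᴴ * Vᴴ = 1 := by rw [← conjTranspose_mul, hVU, conjTranspose_one]
  have hkey : Vᴴ * V - (A - a • 1)ᴴ * (A - a • 1) =
      ((1 - ‖a‖ ^ 2 : ℝ) : ℂ) • (1 - Aᴴ * A) := by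
    have hn : ((1 - ‖a‖ ^ 2 : ℝ) : ℂ) = 1 - a * (starRingEnd ℂ) a := by
      rw [Complex.mul_conj, Complex.normSq_eq_norm_sq]
      push_cast
      rfl
    rw [hn, hV]
    simp only [conjTranspose_sub, conjTranspose_one, conjTranspose_smul, sub_mul, mul_sub, one_mul,
      mul_one, smul_mul_assoc, mul_smul_comm, smul_sub, sub_smul, one_smul, smul_smul,
      RCLike.star_def, Complex.conj_conj]
    module
  calc 1 - ((A - a • 1) * V⁻¹)ᴴ * ((A - a • 1) * V⁻¹)
      = V⁻¹ᴴ * Vᴴ * (V * V⁻¹) - ((A - a • 1) * V⁻¹)ᴴ * ((A - a • 1) * V⁻¹) := by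
        rw [hVU, hUV, one_mul]
    _ = V⁻¹ᴴ * (Vᴴ * V - (A - a • 1)ᴴ * (A - a • 1)) * V⁻¹ := by
        rw [conjTranspose_mul]
        noncomm_ring
    _ = _ := by rw [hkey, mul_smul_comm, smul_mul_assoc]

lemma norm_ne_one_of_moebius_mulVec_eq_smul (hA : ∀ μ ∈ spectrum ℂ A, ‖μ‖ < 1) (ha : ‖a‖ < 1)
    {μ : ℂ} {x : ι → ℂ} (hx : x ≠ 0)
    (h : ((A - a • 1) * (1 - (starRingEnd ℂ) a • A)⁻¹) *ᵥ x = μ • x) : ‖μ‖ ≠ 1 := by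
  intro hμ
  have hdet := isUnit_det_one_sub_conj_smul hA ha
  obtain ⟨y, rfl⟩ : ∃ y, (1 - (starRingEnd ℂ) a • A) *ᵥ y = x :=
    ⟨(1 - (starRingEnd ℂ) a • A)⁻¹ *ᵥ x, by rw [mulVec_mulVec, mul_nonsing_inv _ hdet, one_mulVec]⟩
  have hy : y ≠ 0 := by
    rintro rfl
    simp at hx
  rw [mulVec_mulVec, mul_assoc, nonsing_inv_mul _ hdet, mul_one] at h
  simp only [sub_mulVec, smul_mulVec, one_mulVec, smul_sub, smul_smul] at h
  have hlin : (1 + μ * (starRingEnd ℂ) a) • (A *ᵥ y) = (μ + a) • y := by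
    rw [add_smul, add_smul, one_smul, ← sub_eq_zero, ← sub_eq_zero.2 h]
    abel
  have hμμ : μ * (starRingEnd ℂ) μ = 1 := by
    rw [Complex.mul_conj, Complex.normSq_eq_norm_sq, hμ]
    simp
  have hnorm : ‖1 + μ * (starRingEnd ℂ) a‖ = ‖μ + a‖ := by
    rw [← hμμ, ← mul_add, ← map_add, norm_mul, hμ, RCLike.norm_conj, one_mul]
  have hpos : 0 < ‖μ + a‖ := by
    have := norm_sub_norm_le μ (-a)
    rw [sub_neg_eq_add, norm_neg] at this
    linarith
  have hne : 1 + μ * (starRingEnd ℂ) a ≠ 0 := norm_pos_iff.1 (hnorm ▸ hpos)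
  have hlt := hA ((1 + μ * (starRingEnd ℂ) a)⁻¹ * (μ + a)) (mem_spectrum_of_mulVec_eq_smul hy
    (by rw [mul_smul, ← hlin, inv_smul_smul₀ hne]))
  rw [norm_mul, norm_inv, hnorm, inv_mul_cancel₀ hpos.ne'] at hlt
  exact lt_irrefl _ hlt

lemma commute_moebius (A : Matrix ι ι ℂ) (a b : ℂ) :
    Commute ((A - a • 1) * (1 - (starRingEnd ℂ) a • A)⁻¹)
      ((A - b • 1) * (1 - (starRingEnd ℂ) b • A)⁻¹) := by
  have hnum (c : ℂ) {M : Matrix ι ι ℂ} (h : Commute A M) : Commute (A - c • 1) M :=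
    h.sub_left ((Commute.one_left M).smul_left c)
  have hden (c : ℂ) {M : Matrix ι ι ℂ} (h : Commute A M) :
      Commute (1 - (starRingEnd ℂ) c • A)⁻¹ M := by
    rw [← Matrix.zpow_neg_one]
    exact Matrix.Commute.zpow_left ((Commute.one_left M).sub_left (h.smul_left _)) (-1)
  have hM (c : ℂ) : Commute A ((A - c • 1) * (1 - (starRingEnd ℂ) c • A)⁻¹) :=
    (hnum c (Commute.refl A)).symm.mul_right (hden c (Commute.refl A)).symm
  exact (hnum a (hM b)).mul_left (hden a (hM b))

end Moebius

lemma rank_one_sub_blaschkeMatrix {n d : ℕ} {A : Matrix (Fin n) (Fin n) ℂ}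
    (hA_contr : (1 - Aᴴ * A).PosSemidef) (hA_defect : (1 - Aᴴ * A).rank ≤ 1)
    (hA_stable : ∀ μ ∈ spectrum ℂ A, ‖μ‖ < 1)
    {ζ : ℂ} (hζ : ‖ζ‖ = 1) {α : Fin d → ℂ} (hα : ∀ k, ‖α k‖ < 1) :
    (1 - (blaschkeMatrix ζ α A)ᴴ * blaschkeMatrix ζ α A).rank = min d n := by
  have hζζ : ζ * star ζ = 1 := by
    rw [RCLike.star_def, Complex.mul_conj, Complex.normSq_eq_norm_sq, hζ]
    simp
  rw [blaschkeMatrix, conjTranspose_smul, smul_mul_smul_comm, mul_comm (star ζ), hζζ, one_smul]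
  refine (rank_one_sub_list_prod _ ?_ ?_ ?_ ?_).2.trans (by simp)
  all_goals simp only [List.forall_mem_ofFn_iff]
  · intro k
    rw [one_sub_conjTranspose_mul_moebius (isUnit_det_one_sub_conj_smul hA_stable (hα k))]
    refine (hA_contr.conjTranspose_mul_mul_same _).smul ?_
    rw [Complex.zero_le_real]
    nlinarith [hα k, norm_nonneg (α k)]
  · intro k
    rw [one_sub_conjTranspose_mul_moebius (isUnit_det_one_sub_conj_smul hA_stable (hα k)),
      ← smul_mul_assoc, ← smul_mul_assoc]
    exact (rank_mul_le_left _ _).trans ((rank_mul_le_right _ _).trans hA_defect)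
  · exact fun k μ x hx h ↦ norm_ne_one_of_moebius_mulVec_eq_smul hA_stable (hα k) hx h
  · exact fun k l ↦ commute_moebius A (α k) (α l)

/-- If `A` is a stable contraction with defect index one (`I - Aᴴ A` is PSD of
rank one) and `φ` is a finite Blaschke product of degree `d`, then `I - A Aᴴ`
also has rank one, and the defect indices of `φ(A)` and `φ(Aᴴ)` both equal
`min d n`. -/
theorem stmt_9 {n d : ℕ}
    (A : Matrix (Fin n) (Fin n) ℂ)
    (hA_contr : (1 - Aᴴ * A).PosSemidef)
    (hA_defect : (1 - Aᴴ * A).rank = 1)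
    (hA_stable : ∀ μ ∈ spectrum ℂ A, ‖μ‖ < 1)
    (ζ : ℂ) (hζ : ‖ζ‖ = 1) (α : Fin d → ℂ) (hα : ∀ k, ‖α k‖ < 1) :
    (1 - A * Aᴴ).rank = 1 ∧
    (1 - (blaschkeMatrix ζ α A)ᴴ * blaschkeMatrix ζ α A).rank = min d n ∧
    (1 - (blaschkeMatrix ζ α Aᴴ)ᴴ * blaschkeMatrix ζ α Aᴴ).rank = min d n := by
  have hrank : (1 - A * Aᴴ).rank = 1 :=
    ((rank_one_sub_mul_le_comm A Aᴴ).antisymm (rank_one_sub_mul_le_comm Aᴴ A)).trans hA_defect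
  refine ⟨hrank, rank_one_sub_blaschkeMatrix hA_contr hA_defect.le hA_stable hζ hα,
    rank_one_sub_blaschkeMatrix ?_ ?_ ?_ hζ hα⟩
  · simpa using posSemidef_one_sub_mul_conjTranspose hA_contr
  · simpa using hrank.le
  · intro μ hμ
    rw [← star_eq_conjTranspose, spectrum.map_star] at hμ
    simpa using hA_stable _ hμ
end
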